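/- arXiv:2603.27495 — 2 statements merged into one kernel-verified Lean document; each statement's English description precedes it below -/
import Mathlib

section
/- Let K ≥ 2 be an integer, let a and b be reals with 2 < b < a, and let η_H be a real with 0 < η_H < 1/2. Define F : ℝ → ℝ by F(ω) := ((2cos ω − a)/(2cos ω − b))·(1 − 2η_H cos(Kω)). Then F(ω) ≤ F(π/K) for every ω ∈ [π/K, π). Consequently, no point of the open interval (π/K, π) can be a strict global maximizer of F on [0, π). -/
open Real

/-- For `b < a`, the map `t ↦ (t - a) / (t - b)` is monotone on `(-∞, b)`. -/
lemma div_sub_sub_mono {a b s t : ℝ} (hab : b < a) (hst : s ≤ t) (ht : t < b) :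
    (s - a) / (s - b) ≤ (t - a) / (t - b) := by
  rw [← neg_div_neg_eq (s - a), ← neg_div_neg_eq (t - a),
    div_le_div_iff₀ (by linarith) (by linarith)]
  nlinarith [mul_nonneg (sub_nonneg.2 hab.le) (sub_nonneg.2 hst)]

/-- First step of the proof of Proposition 1: `F(ω) ≤ F(π/K)` for every
`ω ∈ [π/K, π)`; consequently, no point of `(π/K, π)` is a strict global maximizer
of `F` on `[0, π)`. -/
theorem stmt_4 (K : ℕ) (hK : 2 ≤ K) (a b ηH : ℝ) (hb : 2 < b) (hab : b < a)
    (hηH0 : 0 < ηH) (hηH1 : ηH < 1 / 2)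
    (F : ℝ → ℝ)
    (hF : ∀ ω : ℝ, F ω =
      ((2 * Real.cos ω - a) / (2 * Real.cos ω - b)) * (1 - 2 * ηH * Real.cos (K * ω))) :
    (∀ ω ∈ Set.Ico (π / K) π, F ω ≤ F (π / K)) ∧
      (∀ ω ∈ Set.Ioo (π / K) π,
        ¬ (∀ x ∈ Set.Ico (0 : ℝ) π, x ≠ ω → F x < F ω)) := by
  have hKpos : (0 : ℝ) < K := by
    exact_mod_cast (by omega : 0 < K)
  have hpos : 0 < π / K := div_pos pi_pos hKpos
  have hlt : π / K < π := div_lt_self pi_pos (by exact_mod_cast hK)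
  have hmax : ∀ ω ∈ Set.Ico (π / K) π, F ω ≤ F (π / K) := by
    rintro ω ⟨h₁, h₂⟩
    have hcos : cos ω ≤ cos (π / K) := cos_le_cos_of_nonneg_of_le_pi hpos.le h₂.le h₁
    have hle : cos (π / K) ≤ 1 := cos_le_one _
    rw [hF, hF, mul_div_cancel₀ π hKpos.ne', cos_pi]
    apply mul_le_mul
    · exact div_sub_sub_mono hab (by linarith) (by linarith)
    · nlinarith [neg_one_le_cos (K * ω)]
    · nlinarith [cos_le_one (K * ω)]
    · exact div_nonneg_of_nonpos (by linarith) (by linarith)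
  refine ⟨hmax, fun ω hω h ↦ ?_⟩
  exact (h (π / K) ⟨hpos.le, hlt⟩ hω.1.ne).not_ge (hmax ω ⟨hω.1.le, hω.2⟩)
end

section
/- Let K ≥ 2 be an integer and let R > 1 and ζ > 1 be reals. Set η_H := 1/(R^K + R^{-K}), η_J := 1/(ζR^K + ζ^{-1}R^{-K} − (1−ζ)(1−ζ^{-1})·(R^{K−1} − R^{-(K−1)})/(R − R^{-1})), a := ζR + ζ⁻¹R⁻¹, and b := R + R⁻¹. For a bit vector b̄ ∈ {0,1}^K, define zeros α_0(b̄) := ζR if b̄_0 = 1 and α_0(b̄) := (ζR)^{-1} if b̄_0 = 0, and for 1 ≤ k ≤ K−1, α_k(b̄) := R·e^{2πik/K} if b̄_k = 1 and α_k(b̄) := R^{-1}·e^{2πik/K} if b̄_k = 0. Let X_{b̄}(z) := c·∏_{k=0}^{K−1}(z − α_k(b̄)), where c > 0 is the unique positive real such that the sum of the squared moduli of the K+1 coefficients of X_{b̄} equals K+1. Then for every ω ∈ ℝ, |X_{b̄}(e^{iω})|² = (K+1)·(η_J/η_H)·((2cos ω − a)/(2cos ω − b))·(1 − 2η_H·cos(Kω)).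 -/
open Polynomial Real

/-- Parseval's identity with the coefficients summed over a range exceeding the degree. -/
lemma sum_range_sq_norm_coeff_eq_circleAverage (p : ℂ[X]) {N : ℕ} (hp : p.natDegree < N) :
    ∑ j ∈ Finset.range N, ‖p.coeff j‖ ^ 2 = circleAverage (fun z ↦ ‖p.eval z‖ ^ 2) 0 1 := by
  rw [← p.sum_sq_norm_coeff_eq_circleAverage]
  refine (Finset.sum_subset (fun j hj ↦ ?_) fun j _ hj ↦ ?_).symm
  · exact Finset.mem_range.2 ((le_natDegree_of_mem_supp j hj).trans_lt hp)
  · simp [notMem_support_iff.1 hj]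

/-- Polynomials with proportional moduli on the unit circle have proportional energies. -/
lemma sum_range_sq_norm_coeff_eq_mul {p q : ℂ[X]} {N : ℕ} (hp : p.natDegree < N)
    (hq : q.natDegree < N) {κ : ℝ} (h : ∀ z : ℂ, ‖z‖ = 1 → ‖p.eval z‖ = κ * ‖q.eval z‖) :
    ∑ j ∈ Finset.range N, ‖p.coeff j‖ ^ 2 =
      κ ^ 2 * ∑ j ∈ Finset.range N, ‖q.coeff j‖ ^ 2 := by
  rw [sum_range_sq_norm_coeff_eq_circleAverage p hp, sum_range_sq_norm_coeff_eq_circleAverage q hq,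
    ← smul_eq_mul, ← circleAverage_fun_smul]
  refine circleAverage_congr_sphere fun z hz ↦ ?_
  have hz : ‖z‖ = 1 := by simpa using hz
  simp only [h z hz, smul_eq_mul, mul_pow]

lemma normSq_sub_ofReal_of_norm_eq_one {z : ℂ} (hz : ‖z‖ = 1) (r : ℝ) :
    ‖z - r‖ ^ 2 = 1 - 2 * r * z.re + r ^ 2 := by
  have h : z.re * z.re + z.im * z.im = 1 := by
    rw [← Complex.normSq_apply, Complex.normSq_eq_norm_sq, hz, one_pow]
  rw [← Complex.normSq_eq_norm_sq, Complex.normSq_apply]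
  simp only [Complex.sub_re, Complex.sub_im, Complex.ofReal_re, Complex.ofReal_im]
  linear_combination h

/-- Reflecting a zero in the unit circle rescales the modulus on the circle by a constant. -/
lemma exists_norm_sub_ite_inv_eq (b : Bool) {r : ℝ} (hr : 0 < r) {u : ℂ} (hu : ‖u‖ = 1) :
    ∃ κ : ℝ, ∀ z : ℂ, ‖z‖ = 1 →
      ‖z - (if b then (r : ℂ) else (r : ℂ)⁻¹) * u‖ = κ * ‖z - r * u‖ := by
  have hu0 : u ≠ 0 := norm_ne_zero_iff.1 (by rw [hu]; exact one_ne_zero)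
  cases b
  · refine ⟨r⁻¹, fun z hz ↦ ?_⟩
    have key (s : ℝ) : ‖z - s * u‖ ^ 2 = 1 - 2 * s * (z / u).re + s ^ 2 := by
      have hzu : ‖z / u‖ = 1 := by rw [norm_div, hz, hu, div_one]
      rw [← normSq_sub_ofReal_of_norm_eq_one hzu, ← mul_one ‖z / u - s‖, ← hu, ← norm_mul,
        sub_mul, div_mul_cancel₀ _ hu0]
    have hk := key r⁻¹
    push_cast at hk
    simp only [Bool.false_eq_true, if_false]
    rw [← sq_eq_sq₀ (norm_nonneg _) (by positivity), hk, mul_pow, key]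
    field_simp
    ring
  · exact ⟨1, fun z _ ↦ by simp⟩

/-- The polynomial with zeros `s` and the `K`-th roots of `R ^ K` other than `R`. -/
noncomputable def juttedReference (K : ℕ) (R s : ℝ) : ℂ[X] :=
  (X - C (s : ℂ)) * ∑ i ∈ Finset.range K, X ^ i * C (R : ℂ) ^ (K - 1 - i)

lemma prod_X_sub_C_exp_eq_geom_sum (n : ℕ) (R : ℝ) :
    ∏ k : Fin n, (X - C ((R : ℂ) * Complex.exp (2 * π * Complex.I * (k.succ : ℕ) / (n + 1 : ℕ)))) =
      ∑ i ∈ Finset.range (n + 1), X ^ i * C (R : ℂ) ^ (n + 1 - 1 - i) := by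
  refine mul_right_cancel₀ (X_sub_C_ne_zero (R : ℂ)) ?_
  rw [(Commute.all _ _).geom_sum₂_mul, ← C_pow,
    X_pow_sub_C_eq_prod (Complex.isPrimitiveRoot_exp (n + 1) n.succ_ne_zero) n.succ_pos rfl,
    Finset.prod_range_succ', Finset.prod_range]
  congr 1
  · refine Finset.prod_congr rfl fun k _ ↦ ?_
    rw [← Complex.exp_nat_mul, mul_comm (R : ℂ), Fin.val_succ]
    congr 4
    ring
  · simp

lemma natDegree_juttedReference_lt (K : ℕ) (R s : ℝ) :
    (juttedReference K R s).natDegree < K + 1 := by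
  rcases K with _ | n
  · simp [juttedReference]
  refine Nat.lt_succ_of_le (natDegree_mul_le.trans ?_)
  have h : (∑ i ∈ Finset.range (n + 1),
      X ^ i * C (R : ℂ) ^ (n + 1 - 1 - i)).natDegree ≤ n := by
    refine natDegree_sum_le_of_forall_le _ _ fun i hi ↦ ?_
    rw [← C_pow]
    exact (natDegree_mul_C_le _ _).trans
      (by rw [natDegree_X_pow]; exact Nat.le_of_lt_succ (Finset.mem_range.1 hi))
  rw [natDegree_X_sub_C]
  omega

lemma sum_sq_norm_coeff_juttedReference (n : ℕ) (R s : ℝ) :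
    ∑ j ∈ Finset.range (n + 1 + 1), ‖(juttedReference (n + 1) R s).coeff j‖ ^ 2 =
      (s * R ^ n) ^ 2 + (R - s) ^ 2 * ∑ i ∈ Finset.range n, (R ^ 2) ^ i + 1 := by
  have hQ (j : ℕ) : (∑ i ∈ Finset.range (n + 1), X ^ i * C (R : ℂ) ^ (n + 1 - 1 - i)).coeff j =
      if j < n + 1 then (R : ℂ) ^ (n - j) else 0 := by
    simp only [finsetSum_coeff, ← C_pow, coeff_mul_C, coeff_X_pow, ite_mul, one_mul, zero_mul,
      Finset.sum_ite_eq, Finset.mem_range, Nat.add_sub_cancel]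
  rw [Finset.sum_range_succ, Finset.sum_range_succ',
    ← Finset.sum_range_reflect (fun i ↦ (R ^ 2) ^ i),
    Finset.mul_sum]
  simp only [juttedReference, sub_mul, coeff_sub, coeff_C_mul, coeff_X_mul, coeff_X_mul_zero, hQ]
  rw [add_comm ((s * R ^ n) ^ 2)]
  congr 1
  · congr 1
    · refine Finset.sum_congr rfl fun i hi ↦ ?_
      have hi := Finset.mem_range.1 hi
      obtain ⟨m, rfl⟩ : ∃ m, n = i + 1 + m := Nat.exists_eq_add_of_le hi
      rw [if_pos (by omega), if_pos (by omega), show i + 1 + m - i = m + 1 by omega,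
        show i + 1 + m - (i + 1) = m by omega, show i + 1 + m - 1 - i = m by omega,
        show (R : ℂ) ^ (m + 1) - s * R ^ m = (((R - s) * R ^ m : ℝ) : ℂ) by push_cast; ring,
        Complex.norm_real, norm_eq_abs, sq_abs]
      ring
    · simp only [Nat.succ_pos, if_true, Nat.sub_zero, zero_sub, norm_neg]
      rw [← Complex.ofReal_pow, ← Complex.ofReal_mul, Complex.norm_real, norm_eq_abs, sq_abs]
  · simp

lemma sq_norm_eval_juttedReference (K : ℕ) (R s ω : ℝ) :
    ‖(juttedReference K R s).eval (Complex.exp (Complex.I * ω))‖ ^ 2 *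
        (1 - 2 * R * cos ω + R ^ 2) =
      (1 - 2 * s * cos ω + s ^ 2) * (1 - 2 * R ^ K * cos (K * ω) + (R ^ K) ^ 2) := by
  have hz (x : ℝ) : ‖Complex.exp (Complex.I * x)‖ = 1 := by
    rw [mul_comm]; exact Complex.norm_exp_ofReal_mul_I x
  have hre (x : ℝ) : (Complex.exp (Complex.I * x)).re = cos x := by
    rw [mul_comm]; exact Complex.exp_ofReal_mul_I_re x
  have hpow : Complex.exp (Complex.I * ω) ^ K = Complex.exp (Complex.I * (K * ω : ℝ)) := by
    rw [← Complex.exp_nat_mul]; push_cast; ring_nf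
  have h := fun x r ↦ hre x ▸ normSq_sub_ofReal_of_norm_eq_one (hz x) r
  rw [← h, ← h, ← h, ← mul_pow, ← mul_pow, ← norm_mul, ← norm_mul, Complex.ofReal_pow, ← hpow,
    ← (Commute.all _ _).geom_sum₂_mul, juttedReference]
  simp only [eval_mul, eval_sub, eval_X, eval_C, eval_finsetSum, eval_pow, mul_assoc]

open Polynomial Real

/-- Eq. (19) on the unit circle: every codeword of the jutted BMOCZ codebook
(the Huffman constellation except that the zero pair at phase `0` is jutted to radii
`ζR` or `(ζR)⁻¹`) satisfies
`|X_b̄(e^{iω})|² = (K+1)(η_J/η_H)·((2cos ω − a)/(2cos ω − b))·(1 − 2η_H cos(Kω))`. -/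
theorem stmt_15 (K : ℕ) (hK : 2 ≤ K) (R ζ : ℝ) (hR : 1 < R) (hζ : 1 < ζ)
    (ηH ηJ a b : ℝ)
    (hηH : ηH = 1 / (R ^ K + R⁻¹ ^ K))
    (hηJ : ηJ = 1 / (ζ * R ^ K + ζ⁻¹ * R⁻¹ ^ K -
      (1 - ζ) * (1 - ζ⁻¹) * (R ^ (K - 1) - R⁻¹ ^ (K - 1)) / (R - R⁻¹)))
    (ha : a = ζ * R + ζ⁻¹ * R⁻¹)
    (hb : b = R + R⁻¹)
    (bv : Fin K → Bool) (c : ℝ) (hc : 0 < c)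
    (X : Polynomial ℂ)
    (hX : X = Polynomial.C (c : ℂ) * ∏ k : Fin K,
      (Polynomial.X - Polynomial.C
        (if (k : ℕ) = 0 then
          (if bv k then ((ζ * R : ℝ) : ℂ) else ((ζ * R : ℝ) : ℂ)⁻¹)
        else
          (if bv k then (R : ℂ) else (R : ℂ)⁻¹) *
            Complex.exp (2 * π * Complex.I * k / K))))
    (hE : ∑ j ∈ Finset.range (K + 1), ‖X.coeff j‖ ^ 2 = (K : ℝ) + 1) :
    ∀ ω : ℝ, ‖X.eval (Complex.exp (Complex.I * ω))‖ ^ 2 =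
      ((K : ℝ) + 1) * (ηJ / ηH) *
        ((2 * Real.cos ω - a) / (2 * Real.cos ω - b)) *
        (1 - 2 * ηH * Real.cos (K * ω)) := by
  obtain ⟨n, rfl⟩ : ∃ n, K = n + 1 := ⟨K - 1, by omega⟩
  have hR0 : 0 < R := by linarith
  have hζ0 : 0 < ζ := by linarith
  intro ω
  have hu (k : Fin n) :
      ‖Complex.exp (2 * π * Complex.I * (k.succ : ℕ) / (n + 1 : ℕ))‖ = 1 := by
    rw [show 2 * π * Complex.I * (k.succ : ℕ) / (n + 1 : ℕ) =
      ((2 * π * (k.succ : ℕ) / (n + 1 : ℕ) : ℝ) : ℂ) * Complex.I by push_cast; ring]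
    exact Complex.norm_exp_ofReal_mul_I _
  choose κ hκ using fun k : Fin n ↦ exists_norm_sub_ite_inv_eq (bv k.succ) hR0 (hu k)
  obtain ⟨κ₀, hκ₀⟩ := exists_norm_sub_ite_inv_eq (bv 0) (mul_pos hζ0 hR0) norm_one
  obtain ⟨κ', hκ'⟩ : ∃ κ' : ℝ, ∀ z : ℂ, ‖z‖ = 1 →
      ‖X.eval z‖ = κ' * ‖(juttedReference (n + 1) R (ζ * R)).eval z‖ := by
    refine ⟨c * (κ₀ * ∏ k, κ k), fun z hz ↦ ?_⟩
    have h₀ := hκ₀ z hz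
    simp only [mul_one] at h₀
    rw [juttedReference, ← prod_X_sub_C_exp_eq_geom_sum, hX, Fin.prod_univ_succ]
    simp only [eval_mul, eval_C, eval_prod, eval_sub, eval_X, norm_mul, norm_prod, Fin.val_zero,
      if_true, Fin.val_succ, Nat.succ_ne_zero, if_false, Complex.norm_real, norm_eq_abs,
      abs_of_pos hc, h₀]
    simp only [Fin.val_succ] at hκ
    rw [Finset.prod_congr rfl fun k _ ↦ hκ k z hz, Finset.prod_mul_distrib]
    ring
  have hdeg : X.natDegree < n + 1 + 1 := by
    rw [hX]
    refine Nat.lt_succ_of_le ((natDegree_C_mul_le _ _).trans ((natDegree_prod_le _ _).trans ?_))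
    simp only [natDegree_X_sub_C]
    simp
  rw [sum_range_sq_norm_coeff_eq_mul hdeg (natDegree_juttedReference_lt _ _ _) hκ',
    sum_sq_norm_coeff_juttedReference,
    geom_sum_eq (by nlinarith : R ^ 2 ≠ 1)] at hE
  have hY := sq_norm_eval_juttedReference (n + 1) R (ζ * R) ω
  rw [hκ' _ (by rw [mul_comm]; exact Complex.norm_exp_ofReal_mul_I ω), mul_pow]
  generalize ‖(juttedReference (n + 1) R (ζ * R)).eval (Complex.exp (Complex.I * ω))‖ ^ 2 = y at *
  have hP : 0 < 1 - 2 * R * cos ω + R ^ 2 := by nlinarith [cos_le_one ω]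
  have hA : 0 < R ^ n := by positivity
  have hR2 : 0 < R ^ 2 - 1 := by nlinarith
  have hA1 : 0 ≤ (R ^ n) ^ 2 - 1 := by
    nlinarith [one_le_pow₀ hR.le (n := n)]
  rw [← pow_mul, mul_comm 2 n, pow_mul] at hE
  rw [Nat.add_sub_cancel] at hηJ
  simp only [inv_pow, pow_succ R n] at hηH hηJ hY
  generalize R ^ n = A at *
  set E : ℝ := (ζ * R * A) ^ 2 + (R - ζ * R) ^ 2 * ((A ^ 2 - 1) / (R ^ 2 - 1)) + 1 with hEdef
  have hE0 : 0 < E := by positivity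
  have hJ : ηJ = ζ * R * A / E := by
    rw [hηJ, ← one_div_div E, hEdef]
    congr 1
    have : R - R⁻¹ = (R ^ 2 - 1) / R := by field_simp
    rw [this]
    field_simp
    ring
  have hH : ηH = R * A / ((R * A) ^ 2 + 1) := by
    rw [hηH]
    field_simp
  have hab : (2 * cos ω - a) / (2 * cos ω - b) =
      (1 - 2 * (ζ * R) * cos ω + (ζ * R) ^ 2) / (ζ * (1 - 2 * R * cos ω + R ^ 2)) := by
    have h₁ : 2 * cos ω - a = -(1 - 2 * (ζ * R) * cos ω + (ζ * R) ^ 2) / (ζ * R) := by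
      rw [ha]; field_simp; ring
    have h₂ : 2 * cos ω - b = -(1 - 2 * R * cos ω + R ^ 2) / R := by
      rw [hb]; field_simp; ring
    rw [h₁, h₂]
    field_simp
  rw [hab, ← hE, hJ, hH, eq_div_of_mul_eq hP.ne' hY]
  generalize 1 - 2 * R * cos ω + R ^ 2 = P at *
  field_simp
  ring
end
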